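/- The code K3 corrects the following erasure pattern: let j0 ∈ {1,2,3} and let E_1, E_2, E_3 ⊆ {0,1,...,n-1} be sets of erased positions within the three sub-blocks such that |E_j| ≤ n - k - s for each j ≠ j0 and |E_{j0}| ≤ n - k - 2s. If two information vectors produce K3 codewords that agree at every non-erased position (that is, for each j ∈ {1,2,3} the two sub-blocks j agree at all coordinates i ∉ E_j), then the two information vectors are equal. -/

import Mathlib

open Polynomial

lemma K3aux_split {F : Type*} [Field F] (m : ℕ) (A B : F[X])
    (hA : A.degree < (m : WithBot ℕ)) (h : A + X ^ m * B = 0) : A = 0 ∧ B = 0 := by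
  have hB : B = 0 := by
    ext i
    have h1 := congrArg (fun p => coeff p (i + m)) h
    have h2 : A.coeff (i + m) = 0 := by
      apply coeff_eq_zero_of_degree_lt
      refine lt_of_lt_of_le hA ?_
      exact_mod_cast Nat.le_add_left m i
    simpa [coeff_X_pow_mul, h2] using h1
  subst hB
  simpa using h

lemma K3aux_deg {F : Type*} [Field F] (a b N : ℕ) (B : F[X])
    (hB : B.degree < (b : WithBot ℕ)) (h : a + b ≤ N) :
    (X ^ a * B).degree < (N : WithBot ℕ) := by
  rw [degree_lt_iff_coeff_zero] at hB ⊢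
  intro i hi
  rw [coeff_X_pow_mul']
  split_ifs
  · exact hB _ (by omega)
  · rfl

lemma K3aux_add {F : Type*} [Field F] {N : ℕ} {A B : F[X]}
    (hA : A.degree < (N : WithBot ℕ)) (hB : B.degree < (N : WithBot ℕ)) :
    (A + B).degree < (N : WithBot ℕ) :=
  lt_of_le_of_lt (degree_add_le _ _) (max_lt hA hB)

lemma K3aux_sub {F : Type*} [Field F] {N : ℕ} {A B : F[X]}
    (hA : A.degree < (N : WithBot ℕ)) (hB : B.degree < (N : WithBot ℕ)) :
    (A - B).degree < (N : WithBot ℕ) :=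
  lt_of_le_of_lt (degree_sub_le _ _) (max_lt hA hB)

lemma K3aux_zero {F : Type*} [Field F] {n m : ℕ} {α : F} (hα : orderOf α = n) (hm : m ≤ n)
    (E : Finset (Fin n)) (hE : E.card ≤ n - m) (P : F[X]) (hP : P.degree < (m : WithBot ℕ))
    (h : ∀ i : Fin n, i ∉ E → P.eval (α ^ (i : ℕ)) = 0) : P = 0 := by
  classical
  have hc : m ≤ (Eᶜ).card := by
    rw [Finset.card_compl, Fintype.card_fin]; omega
  refine eq_zero_of_degree_lt_of_eval_index_eq_zero (s := Eᶜ) (v := fun i : Fin n => α ^ (i : ℕ)) ?_ ?_ ?_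
  · intro i _ j _ hij
    apply Fin.ext
    exact pow_injOn_Iio_orderOf (by simp [hα]) (by simp [hα]) hij
  · refine lt_of_lt_of_le hP ?_
    exact_mod_cast hc
  · intro i hi
    exact h i (by simpa using hi)

/-- One sub-block: if the top coefficient block `C` vanishes or there are few erasures, the
sub-block polynomial vanishes and so do all of its parts. -/
lemma K3aux_block {F : Type*} [Field F] {n k s : ℕ} {α : F} (hα : orderOf α = n)
    (h4s : 4 * s < k) (hks : k + 2 * s ≤ n) (A1 A2 A3 A4 AI B C : F[X])
    (h1 : A1.degree < (s : WithBot ℕ)) (h2 : A2.degree < (s : WithBot ℕ))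
    (h3 : A3.degree < (s : WithBot ℕ)) (h4 : A4.degree < (s : WithBot ℕ))
    (hI : AI.degree < ((k - 4 * s : ℕ) : WithBot ℕ))
    (hB : B.degree < (s : WithBot ℕ)) (hC : C.degree < (s : WithBot ℕ))
    (E : Finset (Fin n))
    (hE : E.card ≤ n - k - 2 * s ∨ (C = 0 ∧ E.card ≤ n - k - s))
    (h : ∀ i : Fin n, i ∉ E → (A1 + X ^ s * A2 + X ^ (2 * s) * (A3 + A4) + X ^ (3 * s) * A4
      + X ^ (4 * s) * AI + X ^ k * B + X ^ (k + s) * C).eval (α ^ (i : ℕ)) = 0) :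
    A1 = 0 ∧ A2 = 0 ∧ A3 = 0 ∧ A4 = 0 ∧ AI = 0 ∧ B = 0 ∧ C = 0 := by
  have d1 : ∀ N, s ≤ N → A1.degree < (N : WithBot ℕ) := fun N hN =>
    lt_of_lt_of_le h1 (by exact_mod_cast hN)
  have d2 : ∀ N, 2 * s ≤ N → (A1 + X ^ s * A2).degree < (N : WithBot ℕ) := fun N hN =>
    K3aux_add (d1 N (by omega)) (K3aux_deg _ _ _ _ h2 (by omega))
  have d3 : ∀ N, 3 * s ≤ N →
      (A1 + X ^ s * A2 + X ^ (2 * s) * (A3 + A4)).degree < (N : WithBot ℕ) := fun N hN =>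
    K3aux_add (d2 N (by omega)) (K3aux_deg _ _ _ _ (K3aux_add h3 h4) (by omega))
  have d4 : ∀ N, 4 * s ≤ N → (A1 + X ^ s * A2 + X ^ (2 * s) * (A3 + A4)
      + X ^ (3 * s) * A4).degree < (N : WithBot ℕ) := fun N hN =>
    K3aux_add (d3 N (by omega)) (K3aux_deg _ _ _ _ h4 (by omega))
  have d5 : ∀ N, k ≤ N → (A1 + X ^ s * A2 + X ^ (2 * s) * (A3 + A4) + X ^ (3 * s) * A4
      + X ^ (4 * s) * AI).degree < (N : WithBot ℕ) := fun N hN =>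
    K3aux_add (d4 N (by omega)) (K3aux_deg _ _ _ _ hI (by omega))
  have d6 : ∀ N, k + s ≤ N → (A1 + X ^ s * A2 + X ^ (2 * s) * (A3 + A4) + X ^ (3 * s) * A4
      + X ^ (4 * s) * AI + X ^ k * B).degree < (N : WithBot ℕ) := fun N hN =>
    K3aux_add (d5 N (by omega)) (K3aux_deg _ _ _ _ hB (by omega))
  have hz : A1 + X ^ s * A2 + X ^ (2 * s) * (A3 + A4) + X ^ (3 * s) * A4
      + X ^ (4 * s) * AI + X ^ k * B + X ^ (k + s) * C = 0 := by
    rcases hE with hE | ⟨rfl, hE⟩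
    · exact K3aux_zero (m := k + 2 * s) hα hks E (by omega) _
        (K3aux_add (d6 _ (by omega)) (K3aux_deg _ _ _ _ hC (by omega))) h
    · refine K3aux_zero (m := k + s) hα (by omega) E (by omega) _ ?_ h
      rw [mul_zero, add_zero]
      exact d6 _ le_rfl
  obtain ⟨hz, z7⟩ := K3aux_split _ _ _ (d6 _ le_rfl) hz
  obtain ⟨hz, z6⟩ := K3aux_split _ _ _ (d5 _ le_rfl) hz
  obtain ⟨hz, z5⟩ := K3aux_split _ _ _ (d4 _ le_rfl) hz
  obtain ⟨hz, z4⟩ := K3aux_split _ _ _ (d3 _ le_rfl) hz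
  obtain ⟨hz, z3⟩ := K3aux_split _ _ _ (d2 _ le_rfl) hz
  obtain ⟨z1, z2⟩ := K3aux_split _ _ _ (d1 _ le_rfl) hz
  subst z4
  exact ⟨z1, z2, by simpa using z3, rfl, z5, z6, z7⟩

/-- Erasure decoding (second pattern): `K3` corrects `n - k - s` erasures in each of two
sub-blocks when the third has at most `n - k - 2s` erasures: two codewords agreeing on all
non-erased positions come from equal information vectors. -/
theorem K3_erasure_correction_two_heavy
    (F : Type*) [Field F] [Fintype F] [DecidableEq F]
    (n k s : ℕ) (hn : 0 < n) (hk : 0 < k) (hs : 0 < s)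
    (h4s : 4 * s < k) (hks : k + 2 * s ≤ n)
    (hdvd : n ∣ Fintype.card F - 1)
    (α : F) (hα : orderOf α = n)
    -- the information vector: for each sub-unit j, polynomials V_{j,1},…,V_{j,4}
    -- of degree ≤ s-1 and V_{j,I} of degree ≤ k-4s-1
    (V1 V2 V3 V4 VI : Fin 3 → F[X])
    (hV1 : ∀ j, (V1 j).degree < (s : WithBot ℕ))
    (hV2 : ∀ j, (V2 j).degree < (s : WithBot ℕ))
    (hV3 : ∀ j, (V3 j).degree < (s : WithBot ℕ))
    (hV4 : ∀ j, (V4 j).degree < (s : WithBot ℕ))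
    (hVI : ∀ j, (VI j).degree < ((k - 4 * s : ℕ) : WithBot ℕ))
    -- the sub-block polynomials c_j (indices of sub-units taken mod 3)
    (c : Fin 3 → F[X])
    (hc : ∀ j, c j = V1 j + X ^ s * V2 j + X ^ (2 * s) * (V3 j + V4 j)
          + X ^ (3 * s) * V4 j + X ^ (4 * s) * VI j
          + X ^ k * (V2 (j - 1) + V3 (j + 1) + V4 (j + 1))
          + X ^ (k + s) * V1 (j - 1))
    -- the sub-blocks of the codeword: evaluations of c_j at α^0, …, α^{n-1}
    (w : Fin 3 → Fin n → F)
    (hw : ∀ j (i : Fin n), w j i = (c j).eval (α ^ (i : ℕ)))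
    (V1' V2' V3' V4' VI' : Fin 3 → F[X])
    (hV1' : ∀ j, (V1' j).degree < (s : WithBot ℕ))
    (hV2' : ∀ j, (V2' j).degree < (s : WithBot ℕ))
    (hV3' : ∀ j, (V3' j).degree < (s : WithBot ℕ))
    (hV4' : ∀ j, (V4' j).degree < (s : WithBot ℕ))
    (hVI' : ∀ j, (VI' j).degree < ((k - 4 * s : ℕ) : WithBot ℕ))
    (c' : Fin 3 → F[X])
    (hc' : ∀ j, c' j = V1' j + X ^ s * V2' j + X ^ (2 * s) * (V3' j + V4' j)
          + X ^ (3 * s) * V4' j + X ^ (4 * s) * VI' j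
          + X ^ k * (V2' (j - 1) + V3' (j + 1) + V4' (j + 1))
          + X ^ (k + s) * V1' (j - 1))
    (w' : Fin 3 → Fin n → F)
    (hw' : ∀ j (i : Fin n), w' j i = (c' j).eval (α ^ (i : ℕ)))
    (j0 : Fin 3) (E : Fin 3 → Finset (Fin n))
    (hE0 : (E j0).card ≤ n - k - 2 * s)
    (hEj : ∀ j : Fin 3, j ≠ j0 → (E j).card ≤ n - k - s)
    (hagree : ∀ j : Fin 3, ∀ i : Fin n, i ∉ E j → w j i = w' j i) :
    ∀ j : Fin 3, V1 j = V1' j ∧ V2 j = V2' j ∧ V3 j = V3' j ∧ V4 j = V4' j ∧ VI j = VI' j := by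
  have key := fun j (hE : (E j).card ≤ n - k - 2 * s ∨
      (V1 (j - 1) - V1' (j - 1) = 0 ∧ (E j).card ≤ n - k - s)) =>
    K3aux_block hα h4s hks (V1 j - V1' j) (V2 j - V2' j) (V3 j - V3' j) (V4 j - V4' j)
      (VI j - VI' j)
      ((V2 (j - 1) - V2' (j - 1)) + (V3 (j + 1) - V3' (j + 1)) + (V4 (j + 1) - V4' (j + 1)))
      (V1 (j - 1) - V1' (j - 1))
      (K3aux_sub (hV1 j) (hV1' j)) (K3aux_sub (hV2 j) (hV2' j)) (K3aux_sub (hV3 j) (hV3' j))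
      (K3aux_sub (hV4 j) (hV4' j)) (K3aux_sub (hVI j) (hVI' j))
      (K3aux_add (K3aux_add (K3aux_sub (hV2 _) (hV2' _)) (K3aux_sub (hV3 _) (hV3' _)))
        (K3aux_sub (hV4 _) (hV4' _)))
      (K3aux_sub (hV1 _) (hV1' _)) (E j) hE
      (by
        intro i hi
        have h := hagree j i hi
        rw [hw, hw', hc, hc', ← sub_eq_zero, ← eval_sub] at h
        rw [← h]
        congr 1
        ring)
  have e1 : ∀ j : Fin 3, j + 1 - 1 = j := by decide
  have e2 : ∀ j : Fin 3, j + 1 + 1 = j - 1 := by decide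
  have e3 : ∀ j : Fin 3, j - 1 - 1 = j + 1 := by decide
  have e4 : ∀ j : Fin 3, j - 1 + 1 = j := by decide
  have n1 : ∀ j : Fin 3, j + 1 ≠ j := by decide
  have n2 : ∀ j : Fin 3, j - 1 ≠ j := by decide
  have cases3 : ∀ j i : Fin 3, i = j ∨ i = j + 1 ∨ i = j - 1 := by decide
  obtain ⟨a1, a2, a3, a4, aI, -, -⟩ := key j0 (Or.inl hE0)
  obtain ⟨b1, b2, b3, b4, bI, -, -⟩ := key (j0 + 1)
    (Or.inr ⟨by rw [e1]; exact a1, hEj _ (n1 _)⟩)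
  obtain ⟨c1, c2, c3, c4, cI, -, -⟩ := key (j0 - 1)
    (Or.inr ⟨by rw [e3]; exact b1, hEj _ (n2 _)⟩)
  intro j
  rcases cases3 j0 j with rfl | rfl | rfl
  · exact ⟨sub_eq_zero.1 a1, sub_eq_zero.1 a2, sub_eq_zero.1 a3, sub_eq_zero.1 a4,
      sub_eq_zero.1 aI⟩
  · exact ⟨sub_eq_zero.1 b1, sub_eq_zero.1 b2, sub_eq_zero.1 b3, sub_eq_zero.1 b4,
      sub_eq_zero.1 bI⟩
  · exact ⟨sub_eq_zero.1 c1, sub_eq_zero.1 c2, sub_eq_zero.1 c3, sub_eq_zero.1 c4,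
      sub_eq_zero.1 cI⟩
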